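/- For all multi-indices α, β ∈ ℕ^n, it holds that 𝒥(α,β) = 𝒥(β,α). -/

import Mathlib

open MeasureTheory Real

noncomputable def heatG (n : ℕ) (t : ℝ) (x : EuclideanSpace ℝ (Fin n)) : ℝ :=
  (4 * Real.pi * t) ^ (-(n : ℝ) / 2) * Real.exp (-‖x‖ ^ 2 / (4 * t))

/-- `J(α,β) = ∫_0^1 ∫_0^{s₁} ∫∫ x^α y^β G(1-s₁,x) G(s₁-s₂,x-y) G(s₂,y) dx dy ds₂ ds₁`. -/
noncomputable def Jscr (n : ℕ) (α β : Fin n → ℕ) : ℝ :=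
  ∫ s₁ in Set.Ioo (0:ℝ) 1, ∫ s₂ in Set.Ioo (0:ℝ) s₁,
    ∫ x : EuclideanSpace ℝ (Fin n), ∫ y : EuclideanSpace ℝ (Fin n),
      (∏ k, x k ^ α k) * (∏ k, y k ^ β k) *
        heatG n (1 - s₁) x * heatG n (s₁ - s₂) (x - y) * heatG n s₂ y

theorem heatG_nonneg (n : ℕ) {t : ℝ} (ht : 0 < t) (x : EuclideanSpace ℝ (Fin n)) :
    0 ≤ heatG n t x := by
  unfold heatG
  positivity

theorem heatG_neg (n : ℕ) (t : ℝ) (x : EuclideanSpace ℝ (Fin n)) :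
    heatG n t (-x) = heatG n t x := by
  simp [heatG]

theorem measurable_heatG (n : ℕ) :
    Measurable fun p : ℝ × EuclideanSpace ℝ (Fin n) => heatG n p.1 p.2 := by
  unfold heatG
  fun_prop

theorem integrable_heatG (n : ℕ) {t : ℝ} (ht : 0 < t) : Integrable (heatG n t) := by
  have h := GaussianFourier.integrable_cexp_neg_mul_sq_norm_add
    (V := EuclideanSpace ℝ (Fin n)) (b := ((1 / (4 * t) : ℝ) : ℂ))
    (by rw [Complex.ofReal_re]; positivity) 0 0
  have h' := h.norm.const_mul ((4 * Real.pi * t) ^ (-(n : ℝ) / 2))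
  refine h'.congr (Filter.Eventually.of_forall fun x => ?_)
  simp only [heatG, Complex.norm_exp]
  congr 2
  norm_cast
  simp
  ring

theorem integral_heatG (n : ℕ) {t : ℝ} (ht : 0 < t) : ∫ x, heatG n t x = 1 := by
  have h := GaussianFourier.integral_rexp_neg_mul_sq_norm
    (V := EuclideanSpace ℝ (Fin n)) (b := 1 / (4 * t)) (by positivity)
  have h0 : 0 < 4 * Real.pi * t := by positivity
  have h1 : ∀ x : EuclideanSpace ℝ (Fin n),
      -‖x‖ ^ 2 / (4 * t) = -(1 / (4 * t)) * ‖x‖ ^ 2 := fun x => by ring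
  have h2 : Real.pi / (1 / (4 * t)) = 4 * Real.pi * t := by field_simp
  simp only [heatG, h1, integral_const_mul, h, h2, finrank_euclideanSpace, Fintype.card_fin]
  rw [← Real.rpow_add h0, neg_div, neg_add_cancel, Real.rpow_zero]

theorem heatG_le_one (n : ℕ) {t : ℝ} (ht : 2 / 3 ≤ t) (x : EuclideanSpace ℝ (Fin n)) :
    heatG n t x ≤ 1 := by
  have h1 : 1 ≤ 4 * Real.pi * t := by nlinarith [Real.pi_gt_three]
  refine mul_le_one₀ (Real.rpow_le_one_of_one_le_of_nonpos h1 ?_) (Real.exp_nonneg _) ?_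
  · have : (0 : ℝ) ≤ n := n.cast_nonneg
    linarith
  · rw [Real.exp_le_one_iff]
    exact div_nonpos_of_nonpos_of_nonneg (by nlinarith [norm_nonneg x]) (by linarith)

theorem exists_prod_pow_mul_heatG_le (n : ℕ) (α : Fin n → ℕ) :
    ∃ C : ℝ, 0 ≤ C ∧ ∀ (t : ℝ) (x : EuclideanSpace ℝ (Fin n)), 0 < t → t ≤ 1 →
      |∏ k, x k ^ α k| * heatG n t x ≤ C * heatG n (2 * t) x := by
  set m := ∑ k, α k with hm
  refine ⟨(m.factorial * Real.exp 2) * 2 ^ ((n : ℝ) / 2), by positivity, fun t x ht ht1 => ?_⟩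
  have hx : |∏ k, x k ^ α k| ≤ ‖x‖ ^ m := by
    rw [Finset.abs_prod, hm, ← Finset.prod_pow_eq_pow_sum]
    refine Finset.prod_le_prod (fun _ _ => abs_nonneg _) fun k _ => ?_
    rw [abs_pow]
    exact pow_le_pow_left₀ (abs_nonneg _) (PiLp.norm_apply_le x k) _
  have hpow : ‖x‖ ^ m ≤ m.factorial * Real.exp ‖x‖ := by
    have := Real.pow_div_factorial_le_exp ‖x‖ (norm_nonneg x) m
    rwa [div_le_iff₀' (by positivity)] at this
  have hquad : ‖x‖ - ‖x‖ ^ 2 / (8 * t) ≤ 2 := by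
    have : ‖x‖ ^ 2 / 8 ≤ ‖x‖ ^ 2 / (8 * t) := by gcongr; linarith
    nlinarith [sq_nonneg (‖x‖ - 4)]
  have hexp : ‖x‖ ^ m * Real.exp (-‖x‖ ^ 2 / (8 * t)) ≤ m.factorial * Real.exp 2 := by
    calc ‖x‖ ^ m * Real.exp (-‖x‖ ^ 2 / (8 * t))
        ≤ m.factorial * Real.exp ‖x‖ * Real.exp (-‖x‖ ^ 2 / (8 * t)) := by gcongr
      _ = m.factorial * Real.exp (‖x‖ - ‖x‖ ^ 2 / (8 * t)) := by
        rw [mul_assoc, ← Real.exp_add]; congr 2; ring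
      _ ≤ _ := by gcongr
  have hG : heatG n t x =
      Real.exp (-‖x‖ ^ 2 / (8 * t)) * (2 ^ ((n : ℝ) / 2) * heatG n (2 * t) x) := by
    unfold heatG
    rw [show 4 * Real.pi * (2 * t) = 2 * (4 * Real.pi * t) by ring,
      Real.mul_rpow (x := 2) (y := 4 * Real.pi * t) (by positivity) (by positivity),
      show -‖x‖ ^ 2 / (4 * t) = -‖x‖ ^ 2 / (8 * t) + -‖x‖ ^ 2 / (4 * (2 * t)) by
        field_simp; ring, Real.exp_add]
    have : (2 : ℝ) ^ ((n : ℝ) / 2) * 2 ^ (-(n : ℝ) / 2) = 1 := by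
      rw [← Real.rpow_add two_pos, neg_div, add_neg_cancel, Real.rpow_zero]
    linear_combination (-(4 * Real.pi * t) ^ (-(n : ℝ) / 2) * Real.exp (-‖x‖ ^ 2 / (8 * t)) *
      Real.exp (-‖x‖ ^ 2 / (4 * (2 * t)))) * this
  have hG0 := heatG_nonneg n (show 0 < 2 * t by positivity) x
  calc |∏ k, x k ^ α k| * heatG n t x
      ≤ ‖x‖ ^ m * heatG n t x := by
        gcongr
        exact heatG_nonneg n ht x
    _ = ‖x‖ ^ m * Real.exp (-‖x‖ ^ 2 / (8 * t)) * (2 ^ ((n : ℝ) / 2) * heatG n (2 * t) x) := by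
        rw [hG]; ring
    _ ≤ m.factorial * Real.exp 2 * (2 ^ ((n : ℝ) / 2) * heatG n (2 * t) x) := by gcongr
    _ = _ := by ring

/-- The spatial integrand of `Jscr`. -/
noncomputable def heatKernelMonomial (n : ℕ) (α β : Fin n → ℕ) (s₁ s₂ : ℝ)
    (x y : EuclideanSpace ℝ (Fin n)) : ℝ :=
  (∏ k, x k ^ α k) * (∏ k, y k ^ β k) *
    heatG n (1 - s₁) x * heatG n (s₁ - s₂) (x - y) * heatG n s₂ y

/-- Sum of the three pairwise products of heat kernels at doubled times. -/
noncomputable def heatPairSum (n : ℕ) (a b c : ℝ)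
    (p : EuclideanSpace ℝ (Fin n) × EuclideanSpace ℝ (Fin n)) : ℝ :=
  heatG n (2 * a) p.1 * heatG n (2 * b) (p.1 - p.2) +
    heatG n (2 * a) p.1 * heatG n (2 * c) p.2 +
    heatG n (2 * c) p.2 * heatG n (2 * b) (p.1 - p.2)

theorem integrable_heatG_mul_sub (n : ℕ) {a b : ℝ} (ha : 0 < a) (hb : 0 < b) :
    Integrable (fun p : EuclideanSpace ℝ (Fin n) × EuclideanSpace ℝ (Fin n) =>
      heatG n a p.1 * heatG n b (p.1 - p.2)) ∧
    ∫ p : EuclideanSpace ℝ (Fin n) × EuclideanSpace ℝ (Fin n),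
      heatG n a p.1 * heatG n b (p.1 - p.2) = 1 := by
  have hi : Integrable (fun p : EuclideanSpace ℝ (Fin n) × EuclideanSpace ℝ (Fin n) =>
      heatG n a p.1 * heatG n b (p.1 - p.2)) := by
    have h := Integrable.convolution_integrand (ContinuousLinearMap.mul ℝ ℝ)
      (integrable_heatG n ha) (integrable_heatG n hb)
    refine h.swap.congr (Filter.Eventually.of_forall fun p => ?_)
    simp [← heatG_neg n b (p.1 - p.2)]
  refine ⟨hi, ?_⟩
  rw [Measure.volume_eq_prod, integral_prod _ hi]
  simp only [integral_const_mul]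
  simp_rw [fun x => integral_sub_left_eq_self (heatG n b) volume x, integral_heatG n hb, mul_one,
    integral_heatG n ha]

theorem integrable_heatPairSum (n : ℕ) {a b c : ℝ} (ha : 0 < a) (hb : 0 < b) (hc : 0 < c) :
    Integrable (heatPairSum n a b c) ∧ ∫ p, heatPairSum n a b c p = 3 := by
  have ha : 0 < 2 * a := by positivity
  have hb : 0 < 2 * b := by positivity
  have hc : 0 < 2 * c := by positivity
  obtain ⟨i1, e1⟩ := integrable_heatG_mul_sub n ha hb
  have i2 := (integrable_heatG n ha).mul_prod (integrable_heatG n hc)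
  have e2 : ∫ p : EuclideanSpace ℝ (Fin n) × EuclideanSpace ℝ (Fin n),
      heatG n (2 * a) p.1 * heatG n (2 * c) p.2 = 1 := by
    rw [Measure.volume_eq_prod, integral_prod_mul, integral_heatG n ha, integral_heatG n hc,
      mul_one]
  obtain ⟨i3, e3⟩ := integrable_heatG_mul_sub n hc hb
  have hs : (fun p : EuclideanSpace ℝ (Fin n) × EuclideanSpace ℝ (Fin n) =>
      heatG n (2 * c) p.2 * heatG n (2 * b) (p.1 - p.2)) =
      fun p => (fun q : EuclideanSpace ℝ (Fin n) × EuclideanSpace ℝ (Fin n) =>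
        heatG n (2 * c) q.1 * heatG n (2 * b) (q.1 - q.2)) p.swap := by
    funext p
    simp only [Prod.fst_swap, Prod.snd_swap]
    rw [← heatG_neg n _ (p.1 - p.2), neg_sub]
  have i3' : Integrable (fun p : EuclideanSpace ℝ (Fin n) × EuclideanSpace ℝ (Fin n) =>
      heatG n (2 * c) p.2 * heatG n (2 * b) (p.1 - p.2)) := by
    rw [hs]
    exact i3.swap
  have e3' : ∫ p : EuclideanSpace ℝ (Fin n) × EuclideanSpace ℝ (Fin n),
      heatG n (2 * c) p.2 * heatG n (2 * b) (p.1 - p.2) = 1 := by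
    rw [hs, ← e3]
    exact integral_prod_swap (μ := volume) (ν := volume)
      (fun q : EuclideanSpace ℝ (Fin n) × EuclideanSpace ℝ (Fin n) =>
        heatG n (2 * c) q.1 * heatG n (2 * b) (q.1 - q.2))
  have i12 : Integrable (fun p : EuclideanSpace ℝ (Fin n) × EuclideanSpace ℝ (Fin n) =>
      heatG n (2 * a) p.1 * heatG n (2 * b) (p.1 - p.2) +
        heatG n (2 * a) p.1 * heatG n (2 * c) p.2) := i1.add i2
  refine ⟨i12.add i3', ?_⟩
  unfold heatPairSum
  rw [integral_add i12 i3', integral_add i1 i2, e1, e2, e3']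
  norm_num

theorem exists_abs_heatKernelMonomial_le (n : ℕ) (α β : Fin n → ℕ) :
    ∃ C : ℝ, 0 ≤ C ∧ ∀ s₁ s₂ : ℝ, 0 < s₂ → s₂ < s₁ → s₁ < 1 →
      ∀ p : EuclideanSpace ℝ (Fin n) × EuclideanSpace ℝ (Fin n),
      |heatKernelMonomial n α β s₁ s₂ p.1 p.2| ≤
        C * heatPairSum n (1 - s₁) (s₁ - s₂) s₂ p := by
  obtain ⟨A, hA, hA'⟩ := exists_prod_pow_mul_heatG_le n α
  obtain ⟨B, hB, hB'⟩ := exists_prod_pow_mul_heatG_le n β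
  obtain ⟨D, hD, hD'⟩ := exists_prod_pow_mul_heatG_le n 0
  refine ⟨A * B * D, by positivity, fun s₁ s₂ h0 h1 h2 p => ?_⟩
  have hu := hA' (1 - s₁) p.1 (by linarith) (by linarith)
  have hw := hB' s₂ p.2 (by linarith) (by linarith)
  have hv := hD' (s₁ - s₂) (p.1 - p.2) (by linarith) (by linarith)
  simp only [Pi.zero_apply, pow_zero, Finset.prod_const_one, abs_one, one_mul] at hv
  have pu := heatG_nonneg n (show 0 < 1 - s₁ by linarith) p.1
  have pv := heatG_nonneg n (show 0 < s₁ - s₂ by linarith) (p.1 - p.2)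
  have pw := heatG_nonneg n h0 p.2
  have qu := heatG_nonneg n (show 0 < 2 * (1 - s₁) by linarith) p.1
  have qv := heatG_nonneg n (show 0 < 2 * (s₁ - s₂) by linarith) (p.1 - p.2)
  have qw := heatG_nonneg n (show 0 < 2 * s₂ by linarith) p.2
  have key : heatG n (2 * (1 - s₁)) p.1 * heatG n (2 * (s₁ - s₂)) (p.1 - p.2) *
      heatG n (2 * s₂) p.2 ≤ heatPairSum n (1 - s₁) (s₁ - s₂) s₂ p := by
    unfold heatPairSum
    have muv := mul_nonneg qu qv
    have muw := mul_nonneg qu qw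
    have mwv := mul_nonneg qw qv
    have h3 : 1 / 3 ≤ 1 - s₁ ∨ 1 / 3 ≤ s₁ - s₂ ∨ 1 / 3 ≤ s₂ := by
      by_contra! h
      linarith
    rcases h3 with h | h | h
    · have := heatG_le_one n (show 2 / 3 ≤ 2 * (1 - s₁) by linarith) p.1
      nlinarith
    · have := heatG_le_one n (show 2 / 3 ≤ 2 * (s₁ - s₂) by linarith) (p.1 - p.2)
      nlinarith
    · have := heatG_le_one n (show 2 / 3 ≤ 2 * s₂ by linarith) p.2
      nlinarith
  calc |heatKernelMonomial n α β s₁ s₂ p.1 p.2|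
      = (|∏ k, p.1 k ^ α k| * heatG n (1 - s₁) p.1) * heatG n (s₁ - s₂) (p.1 - p.2) *
          (|∏ k, p.2 k ^ β k| * heatG n s₂ p.2) := by
        unfold heatKernelMonomial
        rw [abs_mul, abs_mul, abs_mul, abs_mul, abs_of_nonneg pu, abs_of_nonneg pv,
          abs_of_nonneg pw]
        ring
    _ ≤ (A * heatG n (2 * (1 - s₁)) p.1) * (D * heatG n (2 * (s₁ - s₂)) (p.1 - p.2)) *
          (B * heatG n (2 * s₂) p.2) := by gcongr
    _ = A * B * D * (heatG n (2 * (1 - s₁)) p.1 * heatG n (2 * (s₁ - s₂)) (p.1 - p.2) *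
          heatG n (2 * s₂) p.2) := by ring
    _ ≤ _ := by gcongr

theorem measurable_heatKernelMonomial (n : ℕ) (α β : Fin n → ℕ) :
    Measurable fun q : (ℝ × ℝ) × (EuclideanSpace ℝ (Fin n) × EuclideanSpace ℝ (Fin n)) =>
      heatKernelMonomial n α β q.1.1 q.1.2 q.2.1 q.2.2 := by
  have h1 := (measurable_heatG n).comp
    (f := fun q : (ℝ × ℝ) × (EuclideanSpace ℝ (Fin n) × EuclideanSpace ℝ (Fin n)) =>
      (1 - q.1.1, q.2.1)) (by fun_prop)
  have h2 := (measurable_heatG n).comp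
    (f := fun q : (ℝ × ℝ) × (EuclideanSpace ℝ (Fin n) × EuclideanSpace ℝ (Fin n)) =>
      (q.1.1 - q.1.2, q.2.1 - q.2.2)) (by fun_prop)
  have h3 := (measurable_heatG n).comp
    (f := fun q : (ℝ × ℝ) × (EuclideanSpace ℝ (Fin n) × EuclideanSpace ℝ (Fin n)) =>
      (q.1.2, q.2.2)) (by fun_prop)
  unfold heatKernelMonomial
  refine ((Measurable.mul ?_ h1).mul h2).mul h3
  fun_prop

theorem integrable_heatKernelMonomial (n : ℕ) (α β : Fin n → ℕ) {s₁ s₂ : ℝ} (h0 : 0 < s₂)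
    (h1 : s₂ < s₁) (h2 : s₁ < 1) :
    Integrable (fun p : EuclideanSpace ℝ (Fin n) × EuclideanSpace ℝ (Fin n) =>
      heatKernelMonomial n α β s₁ s₂ p.1 p.2) := by
  obtain ⟨C, -, hC⟩ := exists_abs_heatKernelMonomial_le n α β
  refine ((integrable_heatPairSum n (sub_pos.2 h2) (sub_pos.2 h1) h0).1.const_mul C).mono'
    ?_ (Filter.Eventually.of_forall (hC s₁ s₂ h0 h1 h2))
  exact ((measurable_heatKernelMonomial n α β).comp
    (measurable_prodMk_left (x := (s₁, s₂)))).aestronglyMeasurable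

theorem heatKernelMonomial_symm (n : ℕ) (α β : Fin n → ℕ) (s₁ s₂ : ℝ)
    (x y : EuclideanSpace ℝ (Fin n)) :
    heatKernelMonomial n α β (1 - s₁) (1 - s₂) x y = heatKernelMonomial n β α s₂ s₁ y x := by
  unfold heatKernelMonomial
  rw [show 1 - (1 - s₁) = s₁ by ring, show 1 - s₁ - (1 - s₂) = s₂ - s₁ by ring,
    ← heatG_neg n _ (x - y), neg_sub]
  ring

/-- The open simplex `0 < s₂ < s₁ < 1`. -/
def timeSimplex : Set (ℝ × ℝ) := {s | 0 < s.2 ∧ s.2 < s.1 ∧ s.1 < 1}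

theorem measurableSet_timeSimplex : MeasurableSet timeSimplex :=
  (measurableSet_lt measurable_const measurable_snd).inter
    ((measurableSet_lt measurable_snd measurable_fst).inter
      (measurableSet_lt measurable_fst measurable_const))

/-- The double spatial integral in `Jscr`, extended by zero outside the time simplex. -/
noncomputable def spatialIntegral (n : ℕ) (α β : Fin n → ℕ) : ℝ × ℝ → ℝ :=
  timeSimplex.indicator fun s =>
    ∫ p : EuclideanSpace ℝ (Fin n) × EuclideanSpace ℝ (Fin n),
      heatKernelMonomial n α β s.1 s.2 p.1 p.2

theorem integrable_spatialIntegral (n : ℕ) (α β : Fin n → ℕ) :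
    Integrable (spatialIntegral n α β) := by
  obtain ⟨C, -, hC⟩ := exists_abs_heatKernelMonomial_le n α β
  refine (integrable_indicator_iff measurableSet_timeSimplex).2 ?_
  have hfin : volume timeSimplex < ⊤ := by
    refine (measure_mono (t := Set.Icc (0 : ℝ × ℝ) 1) ?_).trans_lt
      isCompact_Icc.measure_lt_top
    rintro ⟨a, b⟩ ⟨h0, h1, h2⟩
    simp only at h0 h1 h2
    exact ⟨⟨by simp; linarith, by simp; linarith⟩, ⟨by simp; linarith, by simp; linarith⟩⟩
  refine IntegrableOn.of_bound hfin ?_ (C * 3) ?_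
  · exact ((measurable_heatKernelMonomial n α
      β).stronglyMeasurable.integral_prod_right').aestronglyMeasurable
  · refine (ae_restrict_iff' measurableSet_timeSimplex).2 (Filter.Eventually.of_forall ?_)
    rintro ⟨s₁, s₂⟩ ⟨h0, h1, h2⟩
    obtain ⟨hi, he⟩ := integrable_heatPairSum n (sub_pos.2 h2) (sub_pos.2 h1) h0
    rw [← he, ← integral_const_mul]
    exact norm_integral_le_of_norm_le (hi.const_mul C)
      (Filter.Eventually.of_forall (hC s₁ s₂ h0 h1 h2))

theorem spatialIntegral_symm (n : ℕ) (α β : Fin n → ℕ) (s₁ s₂ : ℝ) :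
    spatialIntegral n α β (1 - s₁, 1 - s₂) = spatialIntegral n β α (s₂, s₁) := by
  have hmem : (1 - s₁, 1 - s₂) ∈ timeSimplex ↔ (s₂, s₁) ∈ timeSimplex := by
    simp only [timeSimplex, Set.mem_ofPred_eq]
    constructor <;> rintro ⟨h0, h1, h2⟩ <;> refine ⟨?_, ?_, ?_⟩ <;> linarith
  by_cases h : (s₂, s₁) ∈ timeSimplex
  · rw [spatialIntegral, spatialIntegral, Set.indicator_of_mem h,
      Set.indicator_of_mem (hmem.2 h)]
    simp only [heatKernelMonomial_symm]
    exact integral_prod_swap (μ := volume) (ν := volume)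
      (fun p : EuclideanSpace ℝ (Fin n) × EuclideanSpace ℝ (Fin n) =>
        heatKernelMonomial n β α s₂ s₁ p.1 p.2)
  · rw [spatialIntegral, spatialIntegral, Set.indicator_of_notMem h,
      Set.indicator_of_notMem (mt hmem.1 h)]

theorem Jscr_eq_integral_spatialIntegral (n : ℕ) (α β : Fin n → ℕ) :
    Jscr n α β = ∫ s₁, ∫ s₂, spatialIntegral n α β (s₁, s₂) := by
  unfold Jscr
  rw [← integral_indicator measurableSet_Ioo]
  refine integral_congr_ae (Filter.Eventually.of_forall fun s₁ => ?_)
  simp only [Set.indicator_apply]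
  split_ifs with hs₁
  · rw [← integral_indicator measurableSet_Ioo]
    refine integral_congr_ae (Filter.Eventually.of_forall fun s₂ => ?_)
    beta_reduce
    by_cases hs₂ : s₂ ∈ Set.Ioo 0 s₁
    · rw [spatialIntegral, Set.indicator_of_mem hs₂,
        Set.indicator_of_mem (show (s₁, s₂) ∈ timeSimplex from ⟨hs₂.1, hs₂.2, hs₁.2⟩)]
      exact (integral_prod _ (integrable_heatKernelMonomial n α β hs₂.1 hs₂.2 hs₁.2)).symm
    · rw [spatialIntegral, Set.indicator_of_notMem hs₂,
        Set.indicator_of_notMem fun h : (s₁, s₂) ∈ timeSimplex => hs₂ ⟨h.1, h.2.1⟩]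
  · have : ∀ s₂, spatialIntegral n α β (s₁, s₂) = 0 := fun s₂ =>
      Set.indicator_of_notMem (fun h => hs₁ ⟨h.1.trans h.2.1, h.2.2⟩) _
    simp [this]

theorem Jscr_symm (n : ℕ) (α β : Fin n → ℕ) : Jscr n α β = Jscr n β α := by
  rw [Jscr_eq_integral_spatialIntegral, Jscr_eq_integral_spatialIntegral]
  calc ∫ s₁, ∫ s₂, spatialIntegral n α β (s₁, s₂)
      = ∫ s₁, ∫ s₂, spatialIntegral n α β (1 - s₁, 1 - s₂) := by
        rw [← integral_sub_left_eq_self _ volume (1 : ℝ)]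
        refine integral_congr_ae (Filter.Eventually.of_forall fun s₁ => ?_)
        exact (integral_sub_left_eq_self
          (fun s₂ => spatialIntegral n α β (1 - s₁, s₂)) volume (1 : ℝ)).symm
    _ = ∫ s₁, ∫ s₂, spatialIntegral n β α (s₂, s₁) := by simp only [spatialIntegral_symm]
    _ = ∫ s₂, ∫ s₁, spatialIntegral n β α (s₂, s₁) :=
        integral_integral_swap (integrable_spatialIntegral n β α).swap
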